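/- There is no smooth function v : [0,∞) → ℝ satisfying v''''(t) − 4v''(t) ≥ 6e^{4v(t)} for all t ≥ 0 together with v(0) = 0, v'(0) = 0, −1 < v''(0) ≤ 0, v'''(0) ≥ 0, and lim_{t→∞} v'(t) = −1. -/

import Mathlib

open Real Filter

theorem Real.hasDerivAt_tanh (x : ℝ) : HasDerivAt Real.tanh (1 - Real.tanh x ^ 2) x := by
  have hc := (Real.cosh_pos x).ne'
  have h := (Real.hasDerivAt_sinh x).div (Real.hasDerivAt_cosh x) hc
  have e : Real.tanh = Real.sinh / Real.cosh := by
    funext y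
    exact Real.tanh_eq_sinh_div_cosh y
  rw [e]
  refine h.congr_deriv ?_
  simp only [Pi.div_apply]
  field_simp

theorem Real.exp_neg_four_mul_log_cosh (x : ℝ) :
    Real.exp (4 * -Real.log (Real.cosh x)) = (1 - Real.tanh x ^ 2) ^ 2 := by
  have hc := Real.cosh_pos x
  have e : 4 * -Real.log (Real.cosh x) = -((4 : ℕ) * Real.log (Real.cosh x)) := by
    push_cast
    ring
  have hs : 1 - Real.tanh x ^ 2 = (Real.cosh x ^ 2)⁻¹ := by
    rw [Real.tanh_eq_sinh_div_cosh]
    field_simp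
    linarith [Real.cosh_sq x]
  rw [e, Real.exp_neg, Real.exp_nat_mul, Real.exp_log hc, hs]
  ring

theorem le_of_hasDerivAt_nonneg {f f' : ℝ → ℝ} (hf : ∀ t, HasDerivAt f (f' t) t) {a b : ℝ}
    (hab : a ≤ b) (h : ∀ t ∈ Set.Ioo a b, 0 ≤ f' t) : f a ≤ f b := by
  refine monotoneOn_of_deriv_nonneg (convex_Icc a b)
    (fun t _ => (hf t).continuousAt.continuousWithinAt)
    (fun t _ => (hf t).differentiableAt.differentiableWithinAt) (fun t ht => ?_)
    (Set.left_mem_Icc.2 hab) (Set.right_mem_Icc.2 hab) hab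
  rw [(hf t).deriv]
  exact h t (by simpa using ht)

/-- If the fourth derivative of `u` is nonnegative wherever `u` and its second derivative are, and
the initial data are nonnegative, then the second derivative never drops below its positive
initial value. -/
theorem second_deriv_ge_initial {u u₁ u₂ u₃ u₄ : ℝ → ℝ} (h₁ : ∀ t, HasDerivAt u (u₁ t) t)
    (h₂ : ∀ t, HasDerivAt u₁ (u₂ t) t) (h₃ : ∀ t, HasDerivAt u₂ (u₃ t) t)
    (h₄ : ∀ t, HasDerivAt u₃ (u₄ t) t) (h : ∀ t, 0 ≤ t → 0 ≤ u t → 0 ≤ u₂ t → 0 ≤ u₄ t)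
    (i₀ : 0 ≤ u 0) (i₁ : 0 ≤ u₁ 0) (i₂ : 0 < u₂ 0) (i₃ : 0 ≤ u₃ 0) {t : ℝ} (ht : 0 ≤ t) :
    u₂ 0 ≤ u₂ t := by
  have key : ∀ T, 0 ≤ T → (∀ s, 0 ≤ s → s < T → 0 ≤ u₂ s) → u₂ 0 ≤ u₂ T := by
    intro T hT hs
    have k₁ : ∀ s, 0 ≤ s → s < T → 0 ≤ u₁ s := fun s hs₀ hsT =>
      i₁.trans (le_of_hasDerivAt_nonneg h₂ hs₀ fun r hr => hs r hr.1.le (hr.2.trans hsT))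
    have k₀ : ∀ s, 0 ≤ s → s < T → 0 ≤ u s := fun s hs₀ hsT =>
      i₀.trans (le_of_hasDerivAt_nonneg h₁ hs₀ fun r hr => k₁ r hr.1.le (hr.2.trans hsT))
    have k₃ : ∀ s, 0 ≤ s → s < T → 0 ≤ u₃ s := fun s hs₀ hsT =>
      i₃.trans (le_of_hasDerivAt_nonneg h₄ hs₀ fun r hr =>
        h r hr.1.le (k₀ r hr.1.le (hr.2.trans hsT)) (hs r hr.1.le (hr.2.trans hsT)))
    exact le_of_hasDerivAt_nonneg h₃ hT fun r hr => k₃ r hr.1.le hr.2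
  have nonneg : ∀ s, 0 ≤ s → 0 ≤ u₂ s := by
    by_contra! hneg
    obtain ⟨s, hs, hus⟩ := hneg
    have hcont : Continuous u₂ := continuous_iff_continuousAt.2 fun x => (h₃ x).continuousAt
    obtain ⟨T, ⟨hTs, hT⟩, hmin⟩ := (isCompact_Icc.inter_right
      (isClosed_le hcont continuous_const)).exists_isLeast
        (⟨s, ⟨hs, le_rfl⟩, hus.le⟩ : (Set.Icc 0 s ∩ {x | u₂ x ≤ 0}).Nonempty)
    have := key T hTs.1 fun r hr hrT => by
      by_contra! hr'
      exact absurd (hmin ⟨⟨hr, hrT.le.trans hTs.2⟩, hr'.le⟩) (not_le.2 hrT)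
    exact absurd (i₂.trans_le this) (not_lt.2 hT)
  exact key t ht fun s hs _ => nonneg s hs

/-- Case 2 in the proof of Proposition 2.2 of the paper: there is no smooth `v`
satisfying `v'''' - 4v'' ≥ 6e^{4v}` on `[0,∞)` with `v(0) = v'(0) = 0`,
`-1 < v''(0) ≤ 0`, `v'''(0) ≥ 0` and `v'(t) → -1`. -/
theorem stmt_8 :
    ¬ ∃ v : ℝ → ℝ, ContDiff ℝ (⊤ : ℕ∞) v ∧
      (∀ t ≥ (0 : ℝ),
        deriv^[4] v t - 4 * deriv^[2] v t ≥ 6 * Real.exp (4 * v t)) ∧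
      v 0 = 0 ∧ deriv v 0 = 0 ∧
      (-1 < deriv^[2] v 0 ∧ deriv^[2] v 0 ≤ 0) ∧
      deriv^[3] v 0 ≥ 0 ∧
      Tendsto (deriv v) atTop (nhds (-1)) := by
  rintro ⟨v, hv, hode, hv0, hv1, ⟨hv2, -⟩, hv3, hlim⟩
  have hd : ∀ n t, HasDerivAt (deriv^[n] v) (deriv^[n + 1] v t) t := fun n t => by
    have : ContDiff ℝ (⊤ : ℕ∞) (deriv^[n] v) := hv.iterate_deriv n
    rw [Function.iterate_succ_apply']
    exact (this.differentiable (by simp) t).hasDerivAt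
  have hT := Real.hasDerivAt_tanh
  have h₁ : ∀ t, HasDerivAt (fun t => v t + Real.log (Real.cosh t))
      (deriv v t + Real.tanh t) t := fun t => by
    rw [Real.tanh_eq_sinh_div_cosh]
    exact (hd 0 t).add ((Real.hasDerivAt_cosh t).log (Real.cosh_pos t).ne')
  have h₂ : ∀ t, HasDerivAt (fun t => deriv v t + Real.tanh t)
      (deriv^[2] v t + (1 - Real.tanh t ^ 2)) t := fun t => (hd 1 t).add (hT t)
  have h₃ : ∀ t, HasDerivAt (fun t => deriv^[2] v t + (1 - Real.tanh t ^ 2))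
      (deriv^[3] v t - 2 * (Real.tanh t - Real.tanh t ^ 3)) t := fun t =>
    ((hd 2 t).add (((hT t).pow 2).const_sub 1)).congr_deriv (by push_cast; ring)
  have h₄ : ∀ t, HasDerivAt (fun t => deriv^[3] v t - 2 * (Real.tanh t - Real.tanh t ^ 3))
      (deriv^[4] v t - 2 * (1 - Real.tanh t ^ 2) * (1 - 3 * Real.tanh t ^ 2)) t := fun t =>
    ((hd 3 t).sub (((hT t).sub ((hT t).pow 3)).const_mul 2)).congr_deriv (by push_cast; ring)
  have hcmp : ∀ t, 0 ≤ t → 0 ≤ v t + Real.log (Real.cosh t) →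
      0 ≤ deriv^[2] v t + (1 - Real.tanh t ^ 2) →
      0 ≤ deriv^[4] v t - 2 * (1 - Real.tanh t ^ 2) * (1 - 3 * Real.tanh t ^ 2) := by
    intro t ht hu hu₂
    have hexp : (1 - Real.tanh t ^ 2) ^ 2 ≤ Real.exp (4 * v t) := by
      rw [← Real.exp_neg_four_mul_log_cosh]
      exact Real.exp_le_exp.2 (by linarith)
    nlinarith [hode t ht]
  have hconv : ∀ t, 0 ≤ t →
      deriv^[2] v 0 + 1 ≤ deriv^[2] v t + (1 - Real.tanh t ^ 2) := fun t ht => by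
    have := second_deriv_ge_initial h₁ h₂ h₃ h₄ hcmp (by simp [hv0]) (by simp [hv1])
      (by simp only [Real.tanh_zero]; linarith) (by simpa using hv3) ht
    simp only [Real.tanh_zero] at this
    linarith
  have hgrow : ∀ t, 1 ≤ t → deriv^[2] v 0 ≤ deriv v t := by
    intro t ht
    have := le_of_hasDerivAt_nonneg
      (fun s => (h₂ s).sub ((hasDerivAt_id s).const_mul (deriv^[2] v 0 + 1)))
      (zero_le_one.trans ht) fun s hs => by linarith [hconv s hs.1.le]
    simp only [Pi.sub_apply, hv1, Real.tanh_zero, id] at this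
    nlinarith [Real.tanh_lt_one t]
  exact absurd (ge_of_tendsto hlim ((eventually_ge_atTop 1).mono hgrow)) (not_le.2 hv2)
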